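/- Let A and B be independent random variables taking values in {0,1}^n, and let p ∈ [0,1] be such that Pr[A_i = 0] ≥ p and Pr[B_i = 0] ≥ p for every i ∈ [n]. Then the Shannon entropy of the coordinatewise union satisfies H(A ∪ B) ≥ (p/(2φ))·(H(A) + H(B)). -/

import Mathlib

open scoped Classical in
/-- Probability of an event `E` under the probability mass function `μ`
on a finite sample space. -/
noncomputable def probOf {Ω : Type*} [Fintype Ω] (μ : Ω → ℝ) (E : Ω → Prop) : ℝ :=
  ∑ ω, if E ω then μ ω else 0

/-- Shannon entropy (base 2) of a random variable `X` with values in a finite type,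
under the probability mass function `μ` (note `Real.logb 2 0 = 0` by convention). -/
noncomputable def entropy {Ω V : Type*} [Fintype Ω] [Fintype V] (μ : Ω → ℝ) (X : Ω → V) : ℝ :=
  ∑ v : V, -(probOf μ (fun ω => X ω = v) * Real.logb 2 (probOf μ (fun ω => X ω = v)))

open Real

/-- The cubic is the numerator of `gapDeriv3` below; it is concave on `[0, ∞)`. -/
lemma cubic_pos_of_mem_Ioo {α : ℝ} (hα : 0 ≤ α) {r s t : ℝ} (hr : 0 ≤ r) (hrs : r < s)
    (hst : s < t)
    (h1 : 0 < (2 * α - 4) + 3 * α * r - 4 * r ^ 2 - α * r ^ 3)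
    (h2 : 0 < (2 * α - 4) + 3 * α * t - 4 * t ^ 2 - α * t ^ 3) :
    0 < (2 * α - 4) + 3 * α * s - 4 * s ^ 2 - α * s ^ 3 := by
  have key : (t - r) * ((2 * α - 4) + 3 * α * s - 4 * s ^ 2 - α * s ^ 3) =
      (t - s) * ((2 * α - 4) + 3 * α * r - 4 * r ^ 2 - α * r ^ 3) +
      (s - r) * ((2 * α - 4) + 3 * α * t - 4 * t ^ 2 - α * t ^ 3) +
      (t - s) * (s - r) * (t - r) * (4 + α * (r + s + t)) := by ring
  have e1 : 0 < t - s := by linarith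
  have e2 : 0 < s - r := by linarith
  have e3 : 0 < t - r := by linarith
  have e4 : 0 < s := by linarith
  have e5 : 0 < t := by linarith
  refine pos_of_mul_pos_right (a := t - r) ?_ e3.le
  rw [key]
  positivity

/-- The two sides of Boppana's inequality `α x h(x) ≤ h(x²)` subtracted. -/
noncomputable def gap (α x : ℝ) : ℝ := binEntropy (x ^ 2) - α * (x * binEntropy x)

/-- The first derivative of `gap α` on `(0, 1)`. -/
noncomputable def gapDeriv (α x : ℝ) : ℝ :=
  2 * (x * log (1 - x ^ 2)) - 4 * (x * log x)
    - α * (binEntropy x + x * log (1 - x) - x * log x)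

/-- The second derivative of `gap α` on `(0, 1)`. -/
noncomputable def gapDeriv2 (α x : ℝ) : ℝ :=
  2 * log (1 - x ^ 2) - 4 * log x - 4 / (1 - x ^ 2)
    - α * (2 * log (1 - x) - 2 * log x - 1 / (1 - x))

/-- The third derivative of `gap α` on `(0, 1)`. -/
noncomputable def gapDeriv3 (α x : ℝ) : ℝ :=
  ((2 * α - 4) + 3 * α * x - 4 * x ^ 2 - α * x ^ 3) / (x * (1 - x ^ 2) ^ 2)

lemma hasDerivAt_gap (α : ℝ) {x : ℝ} (h0 : 0 < x) (h1 : x < 1) :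
    HasDerivAt (gap α) (gapDeriv α x) x := by
  have hx2 : x ^ 2 ≠ 0 := by positivity
  have hx3 : x ^ 2 ≠ 1 := by nlinarith
  have d1 := (hasDerivAt_binEntropy hx2 hx3).comp (h := fun y : ℝ => y ^ 2) x (hasDerivAt_pow 2 x)
  have d2 := ((hasDerivAt_id x).mul (hasDerivAt_binEntropy h0.ne' h1.ne)).const_mul α
  refine (d1.sub d2).congr_deriv ?_
  simp only [gapDeriv, log_pow, id]
  push_cast
  ring

lemma hasDerivAt_gapDeriv (α : ℝ) {x : ℝ} (h0 : 0 < x) (h1 : x < 1) :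
    HasDerivAt (gapDeriv α) (gapDeriv2 α x) x := by
  have hx2 : 1 - x ^ 2 ≠ 0 := by nlinarith
  have hx3 : 1 - x ≠ 0 := by linarith
  have d1 := (((hasDerivAt_id x).mul (((hasDerivAt_pow 2 x).const_sub 1).log hx2)).const_mul 2)
  have d2 := (hasDerivAt_mul_log h0.ne').const_mul 4
  have d3 := (((hasDerivAt_binEntropy h0.ne' h1.ne).add ((hasDerivAt_id x).mul
    (((hasDerivAt_id x).const_sub 1).log hx3))).sub (hasDerivAt_mul_log h0.ne')).const_mul α
  refine ((d1.sub d2).sub d3).congr_deriv ?_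
  simp only [gapDeriv2, id]
  field_simp
  ring

lemma hasDerivAt_gapDeriv2 (α : ℝ) {x : ℝ} (h0 : 0 < x) (h1 : x < 1) :
    HasDerivAt (gapDeriv2 α) (gapDeriv3 α x) x := by
  have hx2 : 1 - x ^ 2 ≠ 0 := by nlinarith
  have hx3 : 1 - x ≠ 0 := by linarith
  have hx4 : 1 + x ≠ 0 := by linarith
  have e1 := (hasDerivAt_pow 2 x).const_sub 1
  have e2 := (hasDerivAt_id x).const_sub 1
  have e3 := hasDerivAt_log h0.ne'
  have d := ((((e1.log hx2).const_mul 2).sub (e3.const_mul 4)).sub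
    ((hasDerivAt_const x 4).div e1 hx2)).sub
    (((((e2.log hx3).const_mul 2).sub (e3.const_mul 2)).sub
      ((hasDerivAt_const x 1).div e2 hx3)).const_mul α)
  refine d.congr_deriv ?_
  simp only [gapDeriv3, id]
  have : 1 - x ^ 2 = (1 - x) * (1 + x) := by ring
  rw [this]
  field_simp
  ring

lemma continuous_gap (α : ℝ) : Continuous (gap α) := by
  unfold gap; fun_prop

lemma continuousOn_gapDeriv (α : ℝ) : ContinuousOn (gapDeriv α) (Set.Ico 0 1) := by
  have h1 : ContinuousOn (fun x : ℝ => log (1 - x ^ 2)) (Set.Ico 0 1) :=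
    ContinuousOn.log (by fun_prop) fun x hx => by nlinarith [hx.1, hx.2]
  have h2 : ContinuousOn (fun x : ℝ => log (1 - x)) (Set.Ico 0 1) :=
    ContinuousOn.log (by fun_prop) fun x hx => by linarith [hx.1, hx.2]
  have h3 : ContinuousOn (fun x : ℝ => x * log x) (Set.Ico 0 1) := continuous_mul_log.continuousOn
  have h4 : ContinuousOn binEntropy (Set.Ico 0 1) := binEntropy_continuous.continuousOn
  unfold gapDeriv
  fun_prop

lemma gap_zero (α : ℝ) : gap α 0 = 0 := by simp [gap]

lemma gap_one (α : ℝ) : gap α 1 = 0 := by simp [gap]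

lemma gapDeriv_zero (α : ℝ) : gapDeriv α 0 = 0 := by simp [gapDeriv]

lemma exists_deriv_neg_of_lt {f f' : ℝ → ℝ} {a b : ℝ} (hab : a < b)
    (hc : ContinuousOn f (Set.Icc a b)) (hd : ∀ x ∈ Set.Ioo a b, HasDerivAt f (f' x) x)
    (h : f b < f a) : ∃ c ∈ Set.Ioo a b, f' c < 0 := by
  obtain ⟨c, hc, h'⟩ := exists_hasDerivAt_eq_slope f f' hab hc hd
  exact ⟨c, hc, h' ▸ div_neg_of_neg_of_pos (by linarith) (by linarith)⟩

lemma exists_deriv_pos_of_lt {f f' : ℝ → ℝ} {a b : ℝ} (hab : a < b)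
    (hc : ContinuousOn f (Set.Icc a b)) (hd : ∀ x ∈ Set.Ioo a b, HasDerivAt f (f' x) x)
    (h : f a < f b) : ∃ c ∈ Set.Ioo a b, 0 < f' c := by
  obtain ⟨c, hc, h'⟩ := exists_hasDerivAt_eq_slope f f' hab hc hd
  exact ⟨c, hc, h' ▸ div_pos (by linarith) (by linarith)⟩

lemma goldenRatio_sub_one_mem : 0 < goldenRatio - 1 ∧ goldenRatio - 1 < 1 :=
  ⟨by linarith [one_lt_goldenRatio], by linarith [goldenRatio_lt_two]⟩

lemma gap_goldenRatio_sub_one : gap goldenRatio (goldenRatio - 1) = 0 := by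
  have h := goldenRatio_sq
  have e : (goldenRatio - 1) ^ 2 = 1 - (goldenRatio - 1) := by linarith
  have e' : goldenRatio * (goldenRatio - 1) = 1 := by linarith
  rw [gap, e, binEntropy_one_sub, ← mul_assoc, e']
  ring

lemma log_goldenRatio_sub_one : log (goldenRatio - 1) = - log goldenRatio := by
  rw [← log_inv]
  congr 1
  have e' : goldenRatio * (goldenRatio - 1) = 1 := by linarith [goldenRatio_sq]
  exact eq_inv_of_mul_eq_one_right e'

lemma gapDeriv_goldenRatio_sub_one : gapDeriv goldenRatio (goldenRatio - 1) = 0 := by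
  have h := goldenRatio_sq
  have e : (goldenRatio - 1) ^ 2 = 1 - (goldenRatio - 1) := by linarith
  have e1 : log (1 - (goldenRatio - 1)) = - (2 * log goldenRatio) := by
    rw [← e, log_pow, log_goldenRatio_sub_one]; push_cast; ring
  rw [gapDeriv, binEntropy_eq_negMulLog_add_negMulLog_one_sub, negMulLog, negMulLog, e, e1,
    sub_sub_cancel, log_goldenRatio_sub_one]
  linear_combination (2 * log goldenRatio) * h

lemma gapDeriv2_goldenRatio_sub_one_pos : 0 < gapDeriv2 goldenRatio (goldenRatio - 1) := by
  have h := goldenRatio_sq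
  have e : (goldenRatio - 1) ^ 2 = 1 - (goldenRatio - 1) := by linarith
  have e1 : log (1 - (goldenRatio - 1)) = - (2 * log goldenRatio) := by
    rw [← e, log_pow, log_goldenRatio_sub_one]; push_cast; ring
  have e2 : 1 / (1 - (goldenRatio - 1)) = goldenRatio + 1 := by
    rw [div_eq_iff (by linarith [goldenRatio_lt_two])]; linarith
  have e3 : 4 / (goldenRatio - 1) = 4 * goldenRatio := by
    rw [div_eq_iff (by linarith [one_lt_goldenRatio])]; linarith
  rw [gapDeriv2, e, e1, sub_sub_cancel, e2, e3, log_goldenRatio_sub_one]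
  have hg : 1.618 < goldenRatio := by
    by_contra! hh; nlinarith [goldenRatio_pos]
  have hg' : goldenRatio < 1.62 := by
    by_contra! hh; nlinarith [goldenRatio_pos]
  have hl : 0.46 < log goldenRatio := by
    have h4 : (2 : ℝ) ^ 2 ≤ goldenRatio ^ 3 := by nlinarith
    have := log_le_log (by norm_num) h4
    rw [log_pow, log_pow] at this
    push_cast at this
    linarith [log_two_gt_d9]
  nlinarith

/-- Boppana's inequality. -/
lemma mul_binEntropy_le_binEntropy_sq {x : ℝ} (h0 : 0 ≤ x) (h1 : x ≤ 1) :
    goldenRatio * (x * binEntropy x) ≤ binEntropy (x ^ 2) := by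
  by_contra! hneg
  set α := goldenRatio with hα
  set τ := α - 1 with hτ
  have hαsq : α ^ 2 = α + 1 := goldenRatio_sq
  obtain ⟨hτ0, hτ1⟩ : 0 < τ ∧ τ < 1 := goldenRatio_sub_one_mem
  have hx : gap α x < 0 := by unfold gap; linarith
  have gτ : gap α τ = 0 := gap_goldenRatio_sub_one
  have gτ' : gapDeriv α τ = 0 := gapDeriv_goldenRatio_sub_one
  have cτ : 0 < (2 * α - 4) + 3 * α * τ - 4 * τ ^ 2 - α * τ ^ 3 := by
    have : (2 * α - 4) + 3 * α * τ - 4 * τ ^ 2 - α * τ ^ 3 = 7 * α - 11 := by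
      rw [hτ]; linear_combination (- α ^ 2 + 2 * α - 3) * hαsq
    rw [this]
    by_contra! hh
    nlinarith [goldenRatio_pos]
  have x0 : 0 < x := h0.lt_of_ne (by rintro rfl; simp [gap_zero] at hx)
  have x1 : x < 1 := h1.lt_of_ne (by rintro rfl; simp [gap_one] at hx)
  have xτ : x ≠ τ := by rintro h; rw [h] at hx; linarith
  have den : ∀ y : ℝ, 0 < y → y < 1 → 0 < y * (1 - y ^ 2) ^ 2 := fun y y0 y1 => by
    have : 0 < 1 - y ^ 2 := by nlinarith
    positivity
  have D0 : ∀ {a b : ℝ}, 0 ≤ a → b ≤ 1 → ∀ y ∈ Set.Ioo a b, HasDerivAt (gap α) (gapDeriv α y) y :=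
    fun ha hb y hy => hasDerivAt_gap α (ha.trans_lt hy.1) (hy.2.trans_le hb)
  have D1 : ∀ {a b : ℝ}, 0 ≤ a → b ≤ 1 →
      ∀ y ∈ Set.Ioo a b, HasDerivAt (gapDeriv α) (gapDeriv2 α y) y :=
    fun ha hb y hy => hasDerivAt_gapDeriv α (ha.trans_lt hy.1) (hy.2.trans_le hb)
  have D2 : ∀ {a b : ℝ}, 0 ≤ a → b ≤ 1 →
      ∀ y ∈ Set.Ioo a b, HasDerivAt (gapDeriv2 α) (gapDeriv3 α y) y :=
    fun ha hb y hy => hasDerivAt_gapDeriv2 α (ha.trans_lt hy.1) (hy.2.trans_le hb)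
  have C0 : ∀ {a b : ℝ}, ContinuousOn (gap α) (Set.Icc a b) := (continuous_gap α).continuousOn
  have C1 : ∀ {a b : ℝ}, 0 ≤ a → b < 1 → ContinuousOn (gapDeriv α) (Set.Icc a b) :=
    fun ha hb => (continuousOn_gapDeriv α).mono fun y hy => ⟨ha.trans hy.1, hy.2.trans_lt hb⟩
  have C2 : ∀ {a b : ℝ}, 0 < a → b < 1 → ContinuousOn (gapDeriv2 α) (Set.Icc a b) :=
    fun ha hb y hy => (hasDerivAt_gapDeriv2 α (ha.trans_le hy.1)
      (hy.2.trans_lt hb)).continuousAt.continuousWithinAt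
  rcases lt_or_gt_of_ne xτ with hlt | hgt
  · obtain ⟨y, ⟨y0, yx⟩, hy⟩ := exists_deriv_neg_of_lt x0 C0 (D0 le_rfl h1) (by rwa [gap_zero])
    obtain ⟨z, ⟨xz, zτ⟩, hz⟩ := exists_deriv_pos_of_lt hlt C0 (D0 h0 hτ1.le) (by rwa [gτ])
    obtain ⟨u, ⟨u0, uy⟩, hu⟩ := exists_deriv_neg_of_lt y0 (C1 le_rfl (yx.trans x1))
      (D1 le_rfl (yx.trans x1).le) (by rwa [gapDeriv_zero])
    obtain ⟨v, ⟨yv, vz⟩, hv⟩ := exists_deriv_pos_of_lt (yx.trans xz) (C1 y0.le (zτ.trans hτ1))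
      (D1 y0.le (zτ.trans hτ1).le) (hy.trans hz)
    have z0 := x0.trans xz
    have v0 := y0.trans yv
    obtain ⟨w, ⟨zw, wτ⟩, hw⟩ := exists_deriv_neg_of_lt zτ (C1 z0.le hτ1)
      (D1 z0.le hτ1.le) (by rwa [gτ'])
    have v1 := vz.trans (zτ.trans hτ1)
    obtain ⟨r, ⟨ur, rv⟩, hr⟩ := exists_deriv_pos_of_lt (uy.trans yv) (C2 u0 v1)
      (D2 u0.le v1.le) (hu.trans hv)
    have w1 := wτ.trans hτ1
    obtain ⟨s, ⟨vs, sw⟩, hs⟩ := exists_deriv_neg_of_lt (vz.trans zw) (C2 v0 w1)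
      (D2 v0.le w1.le) (hw.trans hv)
    have r0 := u0.trans ur
    have cr := (div_pos_iff_of_pos_right (den r r0 (rv.trans v1))).1 hr
    have cs := cubic_pos_of_mem_Ioo goldenRatio_pos.le r0.le (rv.trans vs) (sw.trans wτ) cr cτ
    exact hs.not_gt (div_pos cs (den s (v0.trans vs) (sw.trans w1)))
  · obtain ⟨y, ⟨τy, yx⟩, hy⟩ := exists_deriv_neg_of_lt hgt C0 (D0 hτ0.le h1) (by rwa [gτ])
    obtain ⟨z, ⟨xz, z1⟩, hz⟩ := exists_deriv_pos_of_lt x1 C0 (D0 h0 le_rfl) (by rwa [gap_one])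
    have y1 := yx.trans x1
    obtain ⟨u, ⟨τu, uy⟩, hu⟩ := exists_deriv_neg_of_lt τy (C1 hτ0.le y1)
      (D1 hτ0.le y1.le) (by rwa [gτ'])
    have y0 := hτ0.trans τy
    obtain ⟨v, ⟨yv, vz⟩, hv⟩ := exists_deriv_pos_of_lt (yx.trans xz) (C1 y0.le z1)
      (D1 y0.le z1.le) (hy.trans hz)
    have u1 := uy.trans y1
    obtain ⟨s, ⟨τs, su⟩, hs⟩ := exists_deriv_neg_of_lt τu (C2 hτ0 u1)
      (D2 hτ0.le u1.le) (hu.trans gapDeriv2_goldenRatio_sub_one_pos)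
    have v1 := vz.trans z1
    have u0 := hτ0.trans τu
    obtain ⟨t, ⟨ut, tv⟩, ht⟩ := exists_deriv_pos_of_lt (uy.trans yv) (C2 u0 v1)
      (D2 u0.le v1.le) (hu.trans hv)
    have ct := (div_pos_iff_of_pos_right (den t (u0.trans ut) (tv.trans v1))).1 ht
    have cs := cubic_pos_of_mem_Ioo goldenRatio_pos.le hτ0.le τs (su.trans ut) cτ ct
    exact hs.not_gt (div_pos cs (den s (hτ0.trans τs) (su.trans u1)))

lemma binEntropy_exp_neg_mul_exp (u : ℝ) :
    binEntropy (exp (-u)) * exp u = u - (exp u - 1) * log (1 - exp (-u)) := by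
  have h : exp (-u) * exp u = 1 := by rw [← exp_add]; simp
  rw [binEntropy_eq_negMulLog_add_negMulLog_one_sub, negMulLog, negMulLog, log_exp]
  linear_combination (u + log (1 - exp (-u))) * h

lemma concaveOn_binEntropy_exp_neg_mul_exp :
    ConcaveOn ℝ (Set.Ioi 0) fun u : ℝ => binEntropy (exp (-u)) * exp u := by
  simp only [binEntropy_exp_neg_mul_exp]
  have pos : ∀ u ∈ Set.Ioi (0 : ℝ), 0 < 1 - exp (-u) := fun u hu => by
    have : exp (-u) < 1 := exp_lt_one_iff.2 (neg_lt_zero.2 hu)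
    linarith
  have hlog : ∀ u ∈ Set.Ioi (0 : ℝ),
      HasDerivAt (fun u => log (1 - exp (-u))) (exp (-u) / (1 - exp (-u))) u := fun u hu => by
    refine (((hasDerivAt_neg u).exp.const_sub 1).log (pos u hu).ne').congr_deriv ?_
    ring
  have hmul : ∀ u : ℝ, exp u * exp (-u) = 1 := fun u => by rw [← exp_add]; simp
  have h1 : ∀ u ∈ Set.Ioi (0 : ℝ), HasDerivAt (fun u => u - (exp u - 1) * log (1 - exp (-u)))
      (-(exp u * log (1 - exp (-u)))) u := fun u hu => by
    refine ((hasDerivAt_id u).sub (((hasDerivAt_exp u).sub_const 1).mul (hlog u hu))).congr_deriv ?_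
    have := (pos u hu).ne'
    field_simp
    linear_combination -hmul u
  have h2 : ∀ u ∈ Set.Ioi (0 : ℝ), HasDerivAt (fun u => -(exp u * log (1 - exp (-u))))
      (-(exp u * log (1 - exp (-u)) + exp u * (exp (-u) / (1 - exp (-u))))) u :=
    fun u hu => ((hasDerivAt_exp u).mul (hlog u hu)).neg
  refine concaveOn_of_hasDerivWithinAt2_nonpos (convex_Ioi 0)
    (fun u hu => (h1 u hu).continuousAt.continuousWithinAt)
    (fun u hu => (h1 u (interior_subset hu)).hasDerivWithinAt)
    (fun u hu => (h2 u (interior_subset hu)).hasDerivWithinAt) fun u hu => ?_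
  have hu' := pos u (interior_subset hu)
  have hl := one_sub_inv_le_log_of_pos hu'
  have e : 1 - (1 - exp (-u))⁻¹ = -(exp (-u) / (1 - exp (-u))) := by
    field_simp; ring
  rw [e] at hl
  have := mul_le_mul_of_nonneg_left hl (exp_pos u).le
  linarith

/-- The Alweiss–Huang–Sellke inequality. -/
lemma mul_binEntropy_add_le_binEntropy_mul {x y : ℝ} (hx0 : 0 ≤ x) (hx1 : x ≤ 1) (hy0 : 0 ≤ y)
    (hy1 : y ≤ 1) :
    goldenRatio / 2 * (x * binEntropy y + y * binEntropy x) ≤ binEntropy (x * y) := by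
  have hlt := goldenRatio_lt_two
  rcases hx0.eq_or_lt with rfl | hx0
  · simp
  rcases hy0.eq_or_lt with rfl | hy0
  · simp
  rcases hx1.eq_or_lt with rfl | hx1
  · have := binEntropy_nonneg hy0.le hy1
    simp only [one_mul, binEntropy_one, mul_zero, add_zero]
    nlinarith
  rcases hy1.eq_or_lt with rfl | hy1
  · have := binEntropy_nonneg hx0.le hx1.le
    simp only [one_mul, mul_one, binEntropy_one, mul_zero, zero_add]
    nlinarith
  obtain ⟨u, hu⟩ : ∃ u, u = -log x := ⟨_, rfl⟩
  obtain ⟨v, hv⟩ : ∃ v, v = -log y := ⟨_, rfl⟩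
  have hx : x = exp (-u) := by rw [hu, neg_neg, exp_log hx0]
  have hy : y = exp (-v) := by rw [hv, neg_neg, exp_log hy0]
  have u0 : 0 < u := by have := log_neg hx0 hx1; linarith
  have v0 : 0 < v := by have := log_neg hy0 hy1; linarith
  subst hx hy
  have hw : 0 < 1 / 2 * u + 1 / 2 * v := by positivity
  have key := concaveOn_binEntropy_exp_neg_mul_exp.2 (Set.mem_Ioi.2 u0) (Set.mem_Ioi.2 v0)
    (by norm_num : (0 : ℝ) ≤ 1 / 2) (by norm_num : (0 : ℝ) ≤ 1 / 2) (by norm_num)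
  simp only [smul_eq_mul] at key
  set w := 1 / 2 * u + 1 / 2 * v with hw'
  have sq : exp (-u) * exp (-v) = exp (-w) ^ 2 := by
    rw [← exp_add, ← exp_nat_mul]; congr 1; push_cast; linarith
  rw [sq]
  refine le_trans ?_ (mul_binEntropy_le_binEntropy_sq (exp_pos _).le (exp_le_one_iff.2 (by linarith)))
  have hmul : ∀ u : ℝ, exp (-u) * exp u = 1 := fun u => by rw [← exp_add]; simp
  have := mul_le_mul_of_nonneg_left key
    (mul_nonneg goldenRatio_pos.le (mul_pos (exp_pos (-u)) (exp_pos (-v))).le)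
  calc _ = goldenRatio * (exp (-u) * exp (-v)) *
        (1 / 2 * (binEntropy (exp (-u)) * exp u) + 1 / 2 * (binEntropy (exp (-v)) * exp v)) := by
        linear_combination (-goldenRatio / 2 * exp (-v) * binEntropy (exp (-u))) * hmul u +
          (-goldenRatio / 2 * exp (-u) * binEntropy (exp (-v))) * hmul v
    _ ≤ _ := this
    _ = _ := by
        rw [sq]
        linear_combination (goldenRatio * exp (-w) * binEntropy (exp (-w))) * hmul w

/-- The entropy of a bit on an event of mass `m`, the bit vanishing on a part of mass `s`;
this is the unnormalized contribution of the event to a conditional entropy. -/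
noncomputable def massEntropy (s m : ℝ) : ℝ := m * binEntropy (s / m)

lemma massEntropy_zero_zero : massEntropy 0 0 = 0 := by simp [massEntropy]

lemma massEntropy_nonneg {s m : ℝ} (hs : 0 ≤ s) (hsm : s ≤ m) : 0 ≤ massEntropy s m :=
  mul_nonneg (hs.trans hsm) <|
    binEntropy_nonneg (div_nonneg hs (hs.trans hsm)) (div_le_one_of_le₀ hsm (hs.trans hsm))

lemma negMulLog_add_negMulLog {s t : ℝ} (hs : 0 ≤ s) (ht : 0 ≤ t) :
    negMulLog s + negMulLog t = massEntropy s (s + t) + negMulLog (s + t) := by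
  rcases (add_nonneg hs ht).eq_or_lt with h | h
  · obtain ⟨rfl, rfl⟩ : s = 0 ∧ t = 0 := ⟨by linarith, by linarith⟩
    simp [massEntropy]
  · set m := s + t
    have e1 : s = s / m * m := by field_simp
    have e2 : t = (1 - s / m) * m := by rw [sub_mul, ← e1]; simp [m]
    conv_lhs => rw [e1, e2]
    rw [negMulLog_mul, negMulLog_mul, massEntropy, binEntropy_eq_negMulLog_add_negMulLog_one_sub]
    ring

lemma sum_massEntropy_le {ι : Type*} (t : Finset ι) {s m : ι → ℝ} (hs : ∀ i ∈ t, 0 ≤ s i)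
    (hsm : ∀ i ∈ t, s i ≤ m i) :
    ∑ i ∈ t, massEntropy (s i) (m i) ≤ massEntropy (∑ i ∈ t, s i) (∑ i ∈ t, m i) := by
  have hm : ∀ i ∈ t, 0 ≤ m i := fun i hi => (hs i hi).trans (hsm i hi)
  rcases (Finset.sum_nonneg hm).eq_or_lt with h | h
  · have h0 := (Finset.sum_eq_zero_iff_of_nonneg hm).1 h.symm
    rw [Finset.sum_eq_zero fun i hi => by simp [massEntropy, h0 i hi]]
    simp [massEntropy, ← h]
  · set M := ∑ i ∈ t, m i with hM
    have := strictConcave_binEntropy.concaveOn.le_map_sum (t := t) (w := fun i => m i / M)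
      (p := fun i => s i / m i) (fun i hi => div_nonneg (hm i hi) h.le)
      (by rw [← Finset.sum_div, div_self h.ne'])
      (fun i hi => ⟨div_nonneg (hs i hi) (hm i hi), div_le_one_of_le₀ (hsm i hi) (hm i hi)⟩)
    have e : ∑ i ∈ t, m i / M * (s i / m i) = (∑ i ∈ t, s i) / M := by
      rw [Finset.sum_div]
      refine Finset.sum_congr rfl fun i hi => ?_
      rcases (hm i hi).eq_or_lt with h0 | h0
      · have : s i = 0 := le_antisymm (h0 ▸ hsm i hi) (hs i hi)
        simp [this]
      · field_simp
    simp only [smul_eq_mul, e] at this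
    calc _ = M * ∑ i ∈ t, m i / M * binEntropy (s i / m i) := by
          rw [Finset.mul_sum]
          refine Finset.sum_congr rfl fun i _ => ?_
          rw [massEntropy]; field_simp
      _ ≤ _ := mul_le_mul_of_nonneg_left this h.le

lemma massEntropy_mul_ge {s m t k : ℝ} (hs : 0 ≤ s) (hsm : s ≤ m) (ht : 0 ≤ t) (htk : t ≤ k) :
    goldenRatio / 2 * (s * massEntropy t k + t * massEntropy s m) ≤
      massEntropy (s * t) (m * k) := by
  have hm := hs.trans hsm
  have hk := ht.trans htk
  have h := mul_le_mul_of_nonneg_left (mul_binEntropy_add_le_binEntropy_mul (div_nonneg hs hm)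
    (div_le_one_of_le₀ hsm hm) (div_nonneg ht hk) (div_le_one_of_le₀ htk hk)) (mul_nonneg hm hk)
  have e1 : m * (s / m) = s := mul_div_cancel_of_imp' fun h => le_antisymm (h ▸ hsm) hs
  have e2 : k * (t / k) = t := mul_div_cancel_of_imp' fun h => le_antisymm (h ▸ htk) ht
  rw [massEntropy, massEntropy, massEntropy, ← div_mul_div_comm]
  refine le_trans (le_of_eq ?_) h
  linear_combination (-goldenRatio / 2 * k * binEntropy (t / k)) * e1 +
    (-goldenRatio / 2 * m * binEntropy (s / m)) * e2

/-- The distribution of the union of independent sets with distributions `P` and `Q`. -/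
def unionDist {n : ℕ} (P Q : (Fin n → Bool) → ℝ) (c : Fin n → Bool) : ℝ :=
  ∑ a, ∑ b, if (fun i => a i || b i) = c then P a * Q b else 0

/-- The distribution of the last `n` bits. -/
def tailDist {n : ℕ} (P : (Fin (n + 1) → Bool) → ℝ) (a : Fin n → Bool) : ℝ :=
  P (Fin.cons false a) + P (Fin.cons true a)

lemma sum_bool_cons {n : ℕ} (F : (Fin (n + 1) → Bool) → ℝ) :
    ∑ a, F a = ∑ a : Fin n → Bool, (F (Fin.cons false a) + F (Fin.cons true a)) := by
  rw [← (Fin.consEquiv fun _ : Fin (n + 1) => Bool).sum_comp, Fintype.sum_prod_type_right]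
  refine Finset.sum_congr rfl fun a _ => ?_
  rw [Fintype.sum_bool, add_comm]
  rfl

lemma union_cons {n : ℕ} (x y : Bool) (a b : Fin n → Bool) :
    (fun i => (Fin.cons x a : Fin (n + 1) → Bool) i || (Fin.cons y b : Fin (n + 1) → Bool) i) =
      Fin.cons (x || y) (fun i => a i || b i) := by
  ext i
  refine Fin.cases ?_ (fun j => ?_) i <;> simp

lemma unionDist_cons_false {n : ℕ} (P Q : (Fin (n + 1) → Bool) → ℝ) (c : Fin n → Bool) :
    unionDist P Q (Fin.cons false c) =
      unionDist (fun a => P (Fin.cons false a)) (fun b => Q (Fin.cons false b)) c := by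
  simp only [unionDist, sum_bool_cons, union_cons, Fin.cons_inj]
  simp

lemma tailDist_unionDist {n : ℕ} (P Q : (Fin (n + 1) → Bool) → ℝ) (c : Fin n → Bool) :
    tailDist (unionDist P Q) c = unionDist (tailDist P) (tailDist Q) c := by
  simp only [tailDist, unionDist, sum_bool_cons, union_cons, Fin.cons_inj]
  simp only [← Finset.sum_add_distrib]
  refine Finset.sum_congr rfl fun a _ => Finset.sum_congr rfl fun b _ => ?_
  split_ifs <;> simp_all
  ring

lemma unionDist_nonneg {n : ℕ} {P Q : (Fin n → Bool) → ℝ} (hP : ∀ a, 0 ≤ P a)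
    (hQ : ∀ b, 0 ≤ Q b) (c : Fin n → Bool) : 0 ≤ unionDist P Q c :=
  Finset.sum_nonneg fun a _ => Finset.sum_nonneg fun b _ => by
    split_ifs
    exacts [mul_nonneg (hP a) (hQ b), le_rfl]

/-- The chain rule for entropy. -/
lemma sum_negMulLog_cons {n : ℕ} {P : (Fin (n + 1) → Bool) → ℝ} (hP : ∀ a, 0 ≤ P a) :
    ∑ a, negMulLog (P a) = ∑ a, massEntropy (P (Fin.cons false a)) (tailDist P a) +
      ∑ a, negMulLog (tailDist P a) := by
  rw [sum_bool_cons, ← Finset.sum_add_distrib]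
  exact Finset.sum_congr rfl fun a _ => negMulLog_add_negMulLog (hP _) (hP _)

lemma sum_sum_massEntropy_le_unionDist {n : ℕ} {S M T K : (Fin n → Bool) → ℝ}
    (hS : ∀ a, 0 ≤ S a) (hSM : ∀ a, S a ≤ M a) (hT : ∀ b, 0 ≤ T b) (hTK : ∀ b, T b ≤ K b) :
    ∑ a, ∑ b, massEntropy (S a * T b) (M a * K b) ≤
      ∑ c, massEntropy (unionDist S T c) (unionDist M K c) := by
  calc _ = ∑ c : Fin n → Bool, ∑ x : (Fin n → Bool) × (Fin n → Bool),
        massEntropy (if (fun i => x.1 i || x.2 i) = c then S x.1 * T x.2 else 0)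
          (if (fun i => x.1 i || x.2 i) = c then M x.1 * K x.2 else 0) := by
        rw [Finset.sum_comm (s := Finset.univ (α := Fin n → Bool))
          (t := Finset.univ (α := (Fin n → Bool) × (Fin n → Bool))), Fintype.sum_prod_type]
        refine Finset.sum_congr rfl fun a _ => Finset.sum_congr rfl fun b _ => ?_
        rw [Finset.sum_eq_single fun i => a i || b i]
        · simp
        · intro c _ hc
          simp [hc.symm, massEntropy_zero_zero]
        · simp
    _ ≤ _ := Finset.sum_le_sum fun c _ => by
        refine (sum_massEntropy_le _ ?_ ?_).trans_eq ?_
        · intro x _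
          split_ifs
          exacts [mul_nonneg (hS _) (hT _), le_rfl]
        · intro x _
          split_ifs
          exacts [mul_le_mul (hSM _) (hTK _) (hT _) ((hS _).trans (hSM _)), le_rfl]
        · rw [Fintype.sum_prod_type, Fintype.sum_prod_type]; rfl

lemma le_sum_negMulLog_unionDist {p : ℝ} {n : ℕ} {P Q : (Fin n → Bool) → ℝ}
    (hP : ∀ a, 0 ≤ P a) (hQ : ∀ b, 0 ≤ Q b) (hP1 : ∑ a, P a = 1) (hQ1 : ∑ b, Q b = 1)
    (hPp : ∀ i, p ≤ ∑ a, if a i = false then P a else 0)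
    (hQp : ∀ i, p ≤ ∑ b, if b i = false then Q b else 0) :
    goldenRatio / 2 * p * (∑ a, negMulLog (P a) + ∑ b, negMulLog (Q b)) ≤
      ∑ c, negMulLog (unionDist P Q c) := by
  induction n with
  | zero =>
    simp only [Fintype.sum_unique] at hP1 hQ1
    simp only [unionDist, Fintype.sum_unique, hP1, hQ1, if_pos (Subsingleton.elim _ _)]
    simp
  | succ n ih =>
    have hP' : ∀ a, 0 ≤ tailDist P a := fun a => add_nonneg (hP _) (hP _)
    have hQ' : ∀ a, 0 ≤ tailDist Q a := fun a => add_nonneg (hQ _) (hQ _)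
    have marg : ∀ (R : (Fin (n + 1) → Bool) → ℝ) (i : Fin n),
        (∑ a, if a i.succ = false then R a else 0) =
          ∑ a, if a i = false then tailDist R a else 0 := fun R i => by
      rw [sum_bool_cons]
      refine Finset.sum_congr rfl fun a _ => ?_
      simp only [Fin.cons_succ]
      split_ifs <;> simp [tailDist]
    have marg0 : ∀ R : (Fin (n + 1) → Bool) → ℝ,
        (∑ a, if a 0 = false then R a else 0) = ∑ a : Fin n → Bool, R (Fin.cons false a) :=
      fun R => by rw [sum_bool_cons]; simp
    have ih := ih hP' hQ' (by rw [← hP1, sum_bool_cons]; rfl) (by rw [← hQ1, sum_bool_cons]; rfl)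
      (fun i => marg P i ▸ hPp i.succ) (fun i => marg Q i ▸ hQp i.succ)
    rw [sum_negMulLog_cons hP, sum_negMulLog_cons hQ,
      sum_negMulLog_cons (unionDist_nonneg hP hQ)]
    simp only [tailDist_unionDist, unionDist_cons_false]
    have hPs : ∀ a, P (Fin.cons false a) ≤ tailDist P a := fun a => le_add_of_nonneg_right (hP _)
    have hQs : ∀ b, Q (Fin.cons false b) ≤ tailDist Q b := fun b => le_add_of_nonneg_right (hQ _)
    have h1 := sum_sum_massEntropy_le_unionDist (fun a => hP (Fin.cons false a)) hPs
      (fun b => hQ (Fin.cons false b)) hQs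
    have h2 := Finset.sum_le_sum fun a (_ : a ∈ Finset.univ) =>
      Finset.sum_le_sum fun b (_ : b ∈ Finset.univ) =>
        massEntropy_mul_ge (hP (Fin.cons false a)) (hPs a) (hQ (Fin.cons false b)) (hQs b)
    simp only [← Finset.mul_sum, Finset.sum_add_distrib, ← Finset.sum_mul] at h2
    have hp0 := marg0 P ▸ hPp 0
    have hq0 := marg0 Q ▸ hQp 0
    have h3 := mul_le_mul_of_nonneg_right hp0
      (Finset.sum_nonneg fun b (_ : b ∈ Finset.univ) =>
        massEntropy_nonneg (hQ (Fin.cons false b)) (hQs b))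
    have h4 := mul_le_mul_of_nonneg_right hq0
      (Finset.sum_nonneg fun a (_ : a ∈ Finset.univ) =>
        massEntropy_nonneg (hP (Fin.cons false a)) (hPs a))
    have h5 := mul_le_mul_of_nonneg_left (add_le_add h3 h4)
      (div_nonneg goldenRatio_pos.le zero_le_two)
    linarith

lemma sum_ite_probOf {Ω V : Type*} [Fintype Ω] [Fintype V] (μ : Ω → ℝ) (X : Ω → V)
    (E : V → Prop) [DecidablePred E] :
    (∑ v, if E v then probOf μ (fun ω => X ω = v) else 0) = probOf μ fun ω => E (X ω) := by
  classical
  have h : ∀ v, (if E v then probOf μ (fun ω => X ω = v) else 0) =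
      ∑ ω, if X ω = v then (if E (X ω) then μ ω else 0) else 0 := fun v => by
    rw [probOf]
    split_ifs with hv
    · refine Finset.sum_congr rfl fun ω _ => ?_
      split_ifs <;> simp_all
    · refine (Finset.sum_eq_zero fun ω _ => ?_).symm
      split_ifs <;> simp_all
  rw [Finset.sum_congr rfl fun v _ => h v, Finset.sum_comm, probOf]
  refine Finset.sum_congr rfl fun ω _ => ?_
  simp

lemma entropy_eq_sum_negMulLog {Ω V : Type*} [Fintype Ω] [Fintype V] (μ : Ω → ℝ) (X : Ω → V) :
    entropy μ X = (∑ v, negMulLog (probOf μ fun ω => X ω = v)) / log 2 := by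
  rw [entropy, Finset.sum_div]
  refine Finset.sum_congr rfl fun v _ => ?_
  rw [negMulLog, logb]
  ring

/-- If `A, B` are independent random variables with values in `{0,1}^n` such that
`Pr[A_i = 0] ≥ p` and `Pr[B_i = 0] ≥ p` for all `i`, then
`H(A ∪ B) ≥ (p/(2φ)) (H(A) + H(B))`, where `φ = (√5-1)/2` and the union is coordinatewise. -/
theorem entropy_union {Ω : Type*} [Fintype Ω] {n : ℕ}
    (μ : Ω → ℝ) (hμ0 : ∀ ω, 0 ≤ μ ω) (hμ1 : ∑ ω, μ ω = 1)
    (A B : Ω → Fin n → Bool)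
    (hind : ∀ a b : Fin n → Bool,
      probOf μ (fun ω => A ω = a ∧ B ω = b) =
        probOf μ (fun ω => A ω = a) * probOf μ (fun ω => B ω = b))
    (p : ℝ) (hp : p ∈ Set.Icc (0 : ℝ) 1)
    (hA : ∀ i : Fin n, probOf μ (fun ω => A ω i = false) ≥ p)
    (hB : ∀ i : Fin n, probOf μ (fun ω => B ω i = false) ≥ p) :
    entropy μ (fun ω i => A ω i || B ω i) ≥
      p / (2 * ((Real.sqrt 5 - 1) / 2)) * (entropy μ A + entropy μ B) := by
  have nonneg : ∀ E : Ω → Prop, 0 ≤ probOf μ E := fun E =>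
    Finset.sum_nonneg fun ω _ => by split_ifs; exacts [hμ0 ω, le_rfl]
  have total : ∀ X : Ω → Fin n → Bool, ∑ a, probOf μ (fun ω => X ω = a) = 1 := fun X => by
    have := sum_ite_probOf μ X fun _ => True
    simpa [probOf, hμ1] using this
  have key := le_sum_negMulLog_unionDist (p := p) (fun a => nonneg fun ω => A ω = a)
    (fun b => nonneg fun ω => B ω = b) (total A) (total B)
    (fun i => (sum_ite_probOf μ A fun a => a i = false) ▸ hA i)
    (fun i => (sum_ite_probOf μ B fun b => b i = false) ▸ hB i)
  have hU : ∀ c, unionDist (fun a => probOf μ fun ω => A ω = a) (fun b => probOf μ fun ω => B ω = b)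
      c = probOf μ fun ω => (fun i => A ω i || B ω i) = c := fun c => by
    have := sum_ite_probOf μ (fun ω => (A ω, B ω)) fun x => (fun i => x.1 i || x.2 i) = c
    rw [← this, Fintype.sum_prod_type]
    simp only [Prod.mk.injEq, hind, unionDist]
  simp only [hU] at key
  have hc : p / (2 * ((Real.sqrt 5 - 1) / 2)) = goldenRatio / 2 * p := by
    have h5 : (√5) ^ 2 = 5 := sq_sqrt (by norm_num)
    have h1 : 1 < √5 := by rw [lt_sqrt] <;> norm_num
    rw [goldenRatio, div_eq_iff (by linarith)]
    linear_combination (-p / 4) * h5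
  rw [hc, entropy_eq_sum_negMulLog, entropy_eq_sum_negMulLog, entropy_eq_sum_negMulLog, ← add_div,
    ← mul_div_assoc]
  exact div_le_div_of_nonneg_right key (log_pos one_lt_two).le
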